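/- Every bi-infinite binary word that is (11/3)-free and contains no pair of complementary factors of length 4 (i.e., there is no binary word x of length 4 such that both x and its complement x̄ are factors) has the same set of finite factors as either h(f) or the complement of h(f). -/

import Mathlib

/-- `x` occurs as a contiguous block in the infinite word `w : ℕ → α`. -/
def FactorN {α : Type*} (w : ℕ → α) (x : List α) : Prop :=
  ∃ i : ℕ, x = (List.range x.length).map fun k => w (i + k)

/-- the finite word `u` has period `p ≥ 1`. -/
def HasPeriod {α : Type*} (u : List α) (p : ℕ) : Prop :=
  1 ≤ p ∧ ∀ i : ℕ, i + p < u.length → u[i]? = u[i + p]?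

/-- the smallest period of `u`. -/
noncomputable def minPeriod {α : Type*} (u : List α) : ℕ :=
  sInf {p | HasPeriod u p}

/-- the exponent of `u`: its length divided by its smallest period. -/
noncomputable def expo {α : Type*} (u : List α) : ℝ :=
  (u.length : ℝ) / (minPeriod u : ℝ)

/-- the complement of a binary word: each letter is flipped. -/
def comp (x : List Bool) : List Bool := x.map fun b => !b

/-- `x` occurs as a contiguous block in the bi-infinite word `w : ℤ → α`. -/
def FactorZ {α : Type*} (w : ℤ → α) (x : List α) : Prop :=
  ∃ i : ℤ, x = (List.range x.length).map fun k => w (i + k)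

/-- the Fibonacci morphism 0 → 01, 1 → 0 (with 0 = false, 1 = true). -/
def fibm : Bool → List Bool := fun b => if b then [false] else [false, true]

/-- iterates of the Fibonacci morphism on the letter 0. -/
def fibIter : ℕ → List Bool
  | 0 => [false]
  | n + 1 => (fibIter n).flatMap fibm

/-- the morphism h : 0 → 0, 1 → 01. -/
def hmor : Bool → List Bool := fun b => if b then [false, true] else [false]

/-- the infinite binary word h(f), where f is the Fibonacci word. -/
def hF : ℕ → Bool := fun n => ((fibIter (n + 1)).flatMap hmor).getD n false

/-- The block of length `n` of `w` starting at position `i`. -/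
def window (w : ℤ → Bool) (i : ℤ) (n : ℕ) : List Bool :=
  (List.range n).map fun k : ℕ => w (i + k)

lemma factorZ_iff_window (w : ℤ → Bool) (x : List Bool) :
    FactorZ w x ↔ ∃ i, x = window w i x.length := by
  simp [FactorZ, window, ← List.map_eq_flatMap, Function.comp_def]

@[simp] lemma length_window (w : ℤ → Bool) (i : ℤ) (n : ℕ) : (window w i n).length = n := by
  simp [window]

lemma window_add (w : ℤ → Bool) (i : ℤ) (m n : ℕ) :
    window w i (m + n) = window w i m ++ window w (i + m) n := by
  simp [window, List.range_add, Function.comp_def, add_assoc]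

lemma window_succ (w : ℤ → Bool) (i : ℤ) (n : ℕ) :
    window w i (n + 1) = w i :: window w (i + 1) n := by
  rw [add_comm, window_add]
  simp [window]

lemma window_zero (w : ℤ → Bool) (i : ℤ) : window w i 0 = [] := rfl

lemma factorZ_window (w : ℤ → Bool) (i : ℤ) (n : ℕ) : FactorZ w (window w i n) :=
  (factorZ_iff_window _ _).2 ⟨i, by rw [length_window]⟩

lemma FactorZ.exists_window {w : ℤ → Bool} {x : List Bool} (hx : FactorZ w x) :
    ∃ i, x = window w i x.length := (factorZ_iff_window _ _).1 hx

lemma FactorZ.of_infix {w : ℤ → Bool} {x y : List Bool} (hy : FactorZ w y) (hxy : x <:+: y) :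
    FactorZ w x := by
  obtain ⟨i, hi⟩ := hy.exists_window
  obtain ⟨a, b, rfl⟩ := hxy
  refine (factorZ_iff_window _ _).2 ⟨i + a.length, ?_⟩
  rw [List.length_append, List.length_append, window_add, window_add] at hi
  exact (List.append_inj (List.append_inj hi (by simp)).1 (by simp)).2

lemma FactorN.of_infix {w : ℕ → Bool} {x y : List Bool} (hy : FactorN w y) (hxy : x <:+: y) :
    FactorN w x := by
  obtain ⟨i, hi⟩ := hy
  obtain ⟨a, b, rfl⟩ := hxy
  refine ⟨i + a.length, ?_⟩
  rw [List.length_append, List.length_append, List.range_add, List.range_add] at hi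
  simp only [List.map_append, List.map_map] at hi
  have := (List.append_inj (List.append_inj hi (by simp)).1 (by simp)).2
  simpa [Function.comp_def, add_assoc] using this

lemma window_infix (w : ℤ → Bool) (i j : ℤ) (m n : ℕ) (hij : i ≤ j) (hmn : j + m ≤ i + n) :
    window w j m <:+: window w i n := by
  obtain ⟨k, rfl⟩ := Int.le.dest hij
  obtain ⟨l, rfl⟩ : ∃ l, n = k + m + l := ⟨n - (k + m), by omega⟩
  rw [window_add, window_add]
  exact ⟨_, _, rfl⟩

/-- No factor of `w` has exponent at least `11 / 3`: a nonempty word `p` followed by `r`, where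
`p ++ r` has period `p.length`, satisfies `(p ++ r).length < 11 / 3 * p.length`. -/
def PowerFree (w : ℤ → Bool) : Prop :=
  ∀ p r : List Bool, FactorZ w (p ++ r) → p ≠ [] → r <+: p ++ r → 3 * r.length < 8 * p.length

lemma hasPeriod_append {p r : List Bool} (hp : p ≠ []) (h : r <+: p ++ r) :
    HasPeriod (p ++ r) p.length := by
  refine ⟨List.length_pos_iff.2 hp, fun i hi => ?_⟩
  rw [List.length_append] at hi
  rw [List.getElem?_append_right (show p.length ≤ i + p.length by omega), Nat.add_sub_cancel]
  obtain ⟨t, ht⟩ := h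
  rw [← ht, List.getElem?_append_left (by omega)]

lemma powerFree_of_expo_lt {w : ℤ → Bool}
    (hfree : ∀ x : List Bool, FactorZ w x → x ≠ [] → expo x < 11 / 3) : PowerFree w := by
  intro p r hw hp hr
  have h := hfree _ hw (by simp [hp])
  have hper := hasPeriod_append hp hr
  have hle : minPeriod (p ++ r) ≤ p.length := Nat.sInf_le hper
  have hpos : 1 ≤ minPeriod (p ++ r) :=
    (Nat.sInf_mem (s := {q | HasPeriod (p ++ r) q}) ⟨_, hper⟩).1
  have hpos' : (0 : ℝ) < minPeriod (p ++ r) := by exact_mod_cast hpos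
  rw [expo, div_lt_iff₀ hpos'] at h
  have hle' : (minPeriod (p ++ r) : ℝ) ≤ p.length := by exact_mod_cast hle
  have : (3 * r.length : ℝ) < 8 * p.length := by
    push_cast [List.length_append] at h
    linarith
  exact_mod_cast this

lemma comp_comp (x : List Bool) : comp (comp x) = x := by
  simp [comp, Function.comp_def]

lemma factorZ_not_iff (w : ℤ → Bool) (x : List Bool) :
    FactorZ (fun i => !(w i)) x ↔ FactorZ w (comp x) := by
  have key : ∀ (v : ℤ → Bool) (y : List Bool),
      FactorZ v y → FactorZ (fun i => !(v i)) (comp y) := by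
    intro v y hy
    obtain ⟨i, hi⟩ := hy.exists_window
    refine (factorZ_iff_window _ _).2 ⟨i, ?_⟩
    conv_lhs => rw [hi]
    simp [comp, window, Function.comp_def]
  refine ⟨fun h => by simpa using key _ _ h, fun h => by simpa [comp_comp] using key _ _ h⟩

lemma factorN_not_iff (w : ℕ → Bool) (x : List Bool) :
    FactorN (fun i => !(w i)) x ↔ FactorN w (comp x) := by
  have key : ∀ (v : ℕ → Bool) (y : List Bool),
      FactorN v y → FactorN (fun i => !(v i)) (comp y) := by
    rintro v y ⟨i, hi⟩
    refine ⟨i, ?_⟩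
    conv_lhs => rw [hi]
    simp [comp, Function.comp_def]
  refine ⟨fun h => by simpa using key _ _ h, fun h => by simpa [comp_comp] using key _ _ h⟩

lemma PowerFree.not {w : ℤ → Bool} (h : PowerFree w) : PowerFree fun i => !(w i) := by
  intro p r hw hp hr
  rw [factorZ_not_iff] at hw
  have := h (comp p) (comp r) (by simpa [comp] using hw) (by simpa [comp] using hp)
    (by simpa [comp] using hr.map (fun b => !b))
  simpa [comp] using this

/-! ### The words `h(φⁿ(b))` -/

/-- The image of the letter `b` under `h ∘ φⁿ`, where `φ` is the Fibonacci morphism. -/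
def fibBlock : ℕ → Bool → List Bool
  | 0, b => hmor b
  | n + 1, b => (fibm b).flatMap (fibBlock n)

lemma fibBlock_succ_false (n : ℕ) :
    fibBlock (n + 1) false = fibBlock n false ++ fibBlock n true := by
  simp [fibBlock, fibm]

lemma fibBlock_succ_true (n : ℕ) : fibBlock (n + 1) true = fibBlock n false := by
  simp [fibBlock, fibm]

lemma flatMap_fibIter (n k : ℕ) : (fibIter n).flatMap (fibBlock k) = fibBlock (n + k) false := by
  induction n generalizing k with
  | zero => simp [fibIter]
  | succ n ih =>
    rw [fibIter, List.flatMap_assoc, show n + 1 + k = n + (k + 1) by omega, ← ih]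
    rfl

lemma length_fibBlock (n : ℕ) :
    n + 1 ≤ (fibBlock n false).length ∧ n ≤ (fibBlock n true).length ∧
      1 ≤ (fibBlock n true).length ∧
      3 ≤ (fibBlock n false).length + (fibBlock n true).length := by
  induction n with
  | zero => simp [fibBlock, hmor]
  | succ n ih =>
    rw [fibBlock_succ_false, fibBlock_succ_true, List.length_append]
    omega

lemma length_fibBlock_weighted (n : ℕ) :
    6 ≤ (fibBlock n false).length + 3 * (fibBlock n true).length := by
  cases n with
  | zero => simp [fibBlock, hmor]
  | succ n =>
    have := length_fibBlock n
    rw [fibBlock_succ_false, fibBlock_succ_true, List.length_append]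
    omega

lemma fibBlock_ne_nil (n : ℕ) (b : Bool) : fibBlock n b ≠ [] := by
  have := length_fibBlock n
  rw [← List.length_pos_iff]
  cases b <;> omega

/-- `h(φⁿ(01))` and `h(φⁿ(10))` differ only in their last two letters. -/
lemma fibBlock_near_commute (n : ℕ) : ∃ p x y : List Bool, x.length = 2 ∧ y.length = 2 ∧
    fibBlock n false ++ fibBlock n true = p ++ x ∧
    fibBlock n true ++ fibBlock n false = p ++ y := by
  induction n with
  | zero => exact ⟨[false], [false, true], [true, false], by simp [fibBlock, hmor]⟩
  | succ n ih =>
    obtain ⟨p, x, y, hx, hy, h₁, h₂⟩ := ih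
    refine ⟨fibBlock n false ++ p, y, x, hy, hx, ?_, ?_⟩
    · rw [fibBlock_succ_false, fibBlock_succ_true, List.append_assoc, h₂, List.append_assoc]
    · rw [fibBlock_succ_false, fibBlock_succ_true, h₁, List.append_assoc]

lemma fibBlock_prefix {m n : ℕ} (h : m ≤ n) : fibBlock m false <+: fibBlock n false := by
  induction n, h using Nat.le_induction with
  | base => exact List.prefix_rfl
  | succ n _ ih => exact ih.trans ⟨_, (fibBlock_succ_false n).symm⟩

lemma hF_eq (n k : ℕ) (hk : k < (fibBlock n false).length) : (fibBlock n false)[k] = hF k := by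
  have hk' : k < (fibBlock (k + 1) false).length := by
    have := (length_fibBlock (k + 1)).1
    omega
  have hF' : hF k = (fibBlock (k + 1) false)[k] := by
    have : (fibIter (k + 1)).flatMap hmor = fibBlock (k + 1) false := flatMap_fibIter (k + 1) 0
    rw [hF, this, List.getD_eq_getElem _ _ hk']
  rw [hF', (fibBlock_prefix (le_max_left n (k + 1))).getElem hk,
    (fibBlock_prefix (le_max_right n (k + 1))).getElem hk']

lemma factorN_fibBlock (n : ℕ) : FactorN hF (fibBlock n false) := by
  refine ⟨0, List.ext_getElem (by simp) fun k hk _ => ?_⟩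
  simp [hF_eq n k hk]

lemma FactorN.infix_fibBlock {x : List Bool} (hx : FactorN hF x) :
    ∃ n, x <:+: fibBlock n false := by
  obtain ⟨i, hi⟩ := hx
  refine ⟨i + x.length, ?_⟩
  have hlen := (length_fibBlock (i + x.length)).1
  have : x = ((fibBlock (i + x.length) false).drop i).take x.length := by
    conv_lhs => rw [hi]
    refine List.ext_getElem (by simp; omega) fun k hk _ => ?_
    simp [hF_eq]
  have hinf := (List.take_prefix x.length ((fibBlock (i + x.length) false).drop i)).isInfix.trans
    (List.drop_suffix _ _).isInfix
  rwa [← this] at hinf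

/-! ### Tilings of bi-infinite words -/

/-- `w` is the image of `u` under the morphism `g`, the image of the letter `u j` starting at
position `s j`. -/
structure IsTiling (g : Bool → List Bool) (u w : ℤ → Bool) (s : ℤ → ℤ) : Prop where
  step : ∀ j, s (j + 1) = s j + (g (u j)).length
  read : ∀ j, window w (s j) (g (u j)).length = g (u j)

/-- The word has no two consecutive letters `1`. -/
def NoOneOne (u : ℤ → Bool) : Prop := ∀ j, u j = true → u (j + 1) = false

lemma NoOneOne.exists_enum {u : ℤ → Bool} (h : NoOneOne u) :
    ∃ s : ℤ → ℤ, (∀ j, u (s j) = false) ∧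
      ∀ j, s (j + 1) = s j + if u (s j + 1) = true then 2 else 1 := by
  have hprev : ∀ j, u j = true → u (j - 1) = false := fun j hj => by
    by_contra hc
    have := h (j - 1) (by simpa using hc)
    simp_all
  let e : Equiv.Perm {j : ℤ // u j = false} :=
    { toFun := fun j => ⟨j + if u (j + 1) = true then 2 else 1, by
        split_ifs with hj
        · simpa [add_assoc] using h _ hj
        · simpa using hj⟩
      invFun := fun j => ⟨j - if u (j - 1) = true then 2 else 1, by
        split_ifs with hj
        · simpa [sub_sub] using hprev _ hj
        · simpa using hj⟩
      left_inv := by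
        rintro ⟨j, hj⟩
        by_cases hc : u (j + 1) = true
        · simp [hc, show j + 2 - 1 = j + 1 by ring]
        · simp [hc, hj]
      right_inv := by
        rintro ⟨j, hj⟩
        by_cases hc : u (j - 1) = true
        · simp [hc, show j - 2 + 1 = j - 1 by ring]
        · simp [hc, hj] }
  obtain ⟨j₀, hj₀⟩ : ∃ j, u j = false := by
    by_contra! hc
    exact hc 1 (h 0 (by simpa using hc 0))
  refine ⟨fun n => ((e ^ n) ⟨j₀, hj₀⟩ : {j : ℤ // u j = false}), 
    fun n => ((e ^ n) ⟨j₀, hj₀⟩).property, fun n => ?_⟩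
  beta_reduce
  rw [add_comm n 1, zpow_add, zpow_one, Equiv.Perm.mul_apply]
  rfl

lemma IsTiling.window_flatMap {g : Bool → List Bool} {u w : ℤ → Bool} {s : ℤ → ℤ}
    (h : IsTiling g u w s) (i : ℤ) (k : ℕ) :
    window w (s i) ((window u i k).flatMap g).length = (window u i k).flatMap g := by
  induction k generalizing i with
  | zero => rfl
  | succ k ih =>
    rw [window_succ, List.flatMap_cons, List.length_append, window_add, h.read, ← h.step, ih]

lemma IsTiling.factorZ {g : Bool → List Bool} {u w : ℤ → Bool} {s : ℤ → ℤ}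
    (h : IsTiling g u w s) {x : List Bool} (hx : FactorZ u x) : FactorZ w (x.flatMap g) := by
  obtain ⟨i, hi⟩ := hx.exists_window
  rw [hi, ← h.window_flatMap]
  exact factorZ_window _ _ _

lemma IsTiling.exists_le_lt {g : Bool → List Bool} {u w : ℤ → Bool} {s : ℤ → ℤ}
    (h : IsTiling g u w s) (hg : ∀ b, g b ≠ []) (a : ℤ) : ∃ j, s j ≤ a ∧ a < s (j + 1) := by
  have hmono : Monotone fun j => s j - j := monotone_int_of_le_succ fun j => by
    have := List.length_pos_iff.2 (hg (u j))
    rw [h.step]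
    omega
  obtain ⟨j, hj, hmax⟩ := Int.exists_greatest_of_bdd (P := fun j => s j ≤ a)
    ⟨max 0 (a - s 0), fun z hz => by
      by_contra! hc
      have := hmono (show 0 ≤ z by omega)
      simp only at this
      omega⟩
    ⟨min 0 (a - s 0), by
      have := hmono (show min 0 (a - s 0) ≤ 0 by omega)
      simp only at this
      omega⟩
  exact ⟨j, hj, by by_contra! hc; have := hmax _ hc; omega⟩

/-- A word without `11` is the image of a word under the Fibonacci morphism, so tilings by
`h ∘ φⁿ` refine to tilings by `h ∘ φⁿ⁺¹`. -/
lemma IsTiling.desubstitute {n : ℕ} {u w : ℤ → Bool} {s : ℤ → ℤ}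
    (h : IsTiling (fibBlock n) u w s) (hu : NoOneOne u)
    (hzero : ∀ j, ¬(u j = false ∧ u (j + 1) = false ∧ u (j + 2) = false)) :
    ∃ u' s', IsTiling (fibBlock (n + 1)) u' w s' ∧ NoOneOne u' := by
  obtain ⟨t, ht, hstep⟩ := hu.exists_enum
  have hread : ∀ j, window u (t j) (fibm (!(u (t j + 1)))).length = fibm (!(u (t j + 1))) :=
      fun j => by
    have := ht j
    cases hc : u (t j + 1) <;> simp [fibm, window, List.range_succ, hc, this]
  have hfl : ∀ j, fibBlock (n + 1) (!(u (t j + 1))) =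
      (window u (t j) (fibm (!(u (t j + 1)))).length).flatMap (fibBlock n) := fun j => by
    rw [hread]
    rfl
  refine ⟨fun j => !(u (t j + 1)), fun j => s (t j), ⟨fun j => ?_, fun j => ?_⟩, fun j hj => ?_⟩
  · rw [fibBlock, hstep]
    cases hc : u (t j + 1)
    · simp [fibm, h.step, ht]
    · rw [if_pos rfl, show t j + 2 = t j + 1 + 1 by ring, h.step, h.step]
      simp [fibm, ht, hc, add_assoc]
  · rw [hfl, h.window_flatMap]
  · have h1 : u (t j + 1) = false := by simpa using hj
    have h2 := hstep j
    rw [h1, if_neg (by simp)] at h2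
    by_contra hc
    refine hzero (t j) ⟨ht j, h1, ?_⟩
    simpa [h2, add_assoc] using hc

/-- In a power-free word tiled by `h ∘ φⁿ`, the tile `h(φⁿ(0))` does not occur three times in a
row. -/
lemma IsTiling.not_zero_zero_zero {n : ℕ} {u w : ℤ → Bool} {s : ℤ → ℤ} (hw : PowerFree w)
    (h : IsTiling (fibBlock n) u w s) (hu : NoOneOne u) (j : ℤ) :
    ¬(u j = false ∧ u (j + 1) = false ∧ u (j + 2) = false) := by
  rintro ⟨h0, h1, h2⟩
  have key : ∀ q : List Bool, q <+: fibBlock n false ++ q →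
      FactorZ w (fibBlock n false ++ (fibBlock n false ++ (fibBlock n false ++ q))) →
      3 * q.length < 2 * (fibBlock n false).length := by
    intro q hq hf
    have := hw _ _ hf (fibBlock_ne_nil _ _)
      (by simpa only [List.prefix_append_right_inj] using hq)
    simp only [List.length_append] at this
    omega
  have hlen := length_fibBlock n
  have hlen' := length_fibBlock_weighted n
  cases h3 : u (j + 3) with
  | false =>
    have hf := h.factorZ (factorZ_window u j 4)
    simp only [window_succ, window_zero, add_assoc, Int.reduceAdd, h0, h1, h2, h3,
      List.flatMap_cons, List.flatMap_nil, List.append_nil] at hf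
    have := key _ (List.prefix_append _ _) hf
    omega
  | true =>
    have h4 : u (j + 4) = false := by simpa [add_assoc] using hu _ h3
    have hf := h.factorZ (factorZ_window u j 5)
    simp only [window_succ, window_zero, add_assoc, Int.reduceAdd, h0, h1, h2, h3, h4,
      List.flatMap_cons, List.flatMap_nil, List.append_nil] at hf
    obtain ⟨p, x, y, hx, hy, e₁, e₂⟩ := fibBlock_near_commute n
    have hp : p <+: fibBlock n false ++ p := by
      refine List.prefix_of_prefix_length_le (l₃ := fibBlock n false ++ p ++ y)
        ⟨x ++ fibBlock n false, ?_⟩ (List.prefix_append _ _) (by simp)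
      rw [← List.append_assoc, ← e₁, List.append_assoc, List.append_assoc, e₂]
    have hpf := key p hp (hf.of_infix (List.IsPrefix.isInfix (by
      simp only [List.prefix_append_right_inj, e₂, List.prefix_append])))
    have := congrArg List.length e₁
    simp only [List.length_append] at this
    omega

lemma exists_tiling_zero {w : ℤ → Bool} (h11 : NoOneOne w)
    (h101 : ∀ j, ¬(w j = true ∧ w (j + 1) = false ∧ w (j + 2) = true)) :
    ∃ u s, IsTiling (fibBlock 0) u w s ∧ NoOneOne u := by
  obtain ⟨s, hs, hstep⟩ := h11.exists_enum
  refine ⟨fun j => w (s j + 1), s, ⟨fun j => ?_, fun j => ?_⟩, fun j hj => ?_⟩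
  · rw [hstep]
    cases w (s j + 1) <;> simp [fibBlock, hmor]
  · have := hs j
    cases hc : w (s j + 1) <;> simp [fibBlock, hmor, window, List.range_succ, hc, this]
  · have h2 := hstep j
    simp only at hj
    rw [if_pos hj] at h2
    by_contra hc
    refine h101 (s j + 1) ⟨hj, ?_, ?_⟩
    · simpa [h2, add_assoc] using hs (j + 1)
    · simpa [h2, add_assoc] using hc

lemma exists_tiling {w : ℤ → Bool} (hw : PowerFree w) (h11 : NoOneOne w)
    (h101 : ∀ j, ¬(w j = true ∧ w (j + 1) = false ∧ w (j + 2) = true)) (n : ℕ) :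
    ∃ u s, IsTiling (fibBlock n) u w s ∧ NoOneOne u := by
  induction n with
  | zero => exact exists_tiling_zero h11 h101
  | succ n ih =>
    obtain ⟨u, s, h, hu⟩ := ih
    exact h.desubstitute hu fun j => h.not_zero_zero_zero hw hu j

lemma fibBlock_pair_infix (n : ℕ) (b c : Bool) (hbc : b = true → c = false) :
    fibBlock n b ++ fibBlock n c <:+: fibBlock (n + 3) false := by
  have e : fibBlock (n + 3) false = fibBlock n false ++ (fibBlock n true ++ (fibBlock n false ++
      (fibBlock n false ++ fibBlock n true))) := by
    simp only [fibBlock_succ_false, fibBlock_succ_true, List.append_assoc]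
  rw [e]
  cases b <;> cases c
  · exact ⟨fibBlock n false ++ fibBlock n true, fibBlock n true, by simp⟩
  · exact ⟨[], fibBlock n false ++ (fibBlock n false ++ fibBlock n true), by simp⟩
  · exact ⟨fibBlock n false, fibBlock n false ++ fibBlock n true, by simp⟩
  · simp at hbc

lemma factorZ_iff_factorN_hF {w : ℤ → Bool} (hw : PowerFree w) (h11 : NoOneOne w)
    (h101 : ∀ j, ¬(w j = true ∧ w (j + 1) = false ∧ w (j + 2) = true)) (x : List Bool) :
    FactorZ w x ↔ FactorN hF x := by
  constructor
  · intro hx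
    obtain ⟨a, ha⟩ := hx.exists_window
    obtain ⟨u, s, h, hu⟩ := exists_tiling hw h11 h101 x.length
    obtain ⟨j, hj, hj'⟩ := h.exists_le_lt (fibBlock_ne_nil _) a
    have hlen : x.length ≤ (fibBlock x.length (u (j + 1))).length := by
      have := length_fibBlock x.length
      cases u (j + 1) <;> omega
    have hread := h.window_flatMap j 2
    simp only [window_succ, window_zero, List.flatMap_cons, List.flatMap_nil,
      List.append_nil] at hread
    refine (factorN_fibBlock (x.length + 3)).of_infix
      (List.IsInfix.trans ?_ (fibBlock_pair_infix x.length (u j) (u (j + 1)) (hu j)))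
    rw [← hread, ha, length_window]
    refine window_infix _ _ _ _ _ hj ?_
    rw [h.step] at hj'
    rw [List.length_append]
    omega
  · intro hx
    obtain ⟨n, hn⟩ := hx.infix_fibBlock
    obtain ⟨u, s, h, hu⟩ := exists_tiling hw h11 h101 n
    obtain ⟨j, hj⟩ : ∃ j, u j = false := by
      by_contra! hc
      exact hc 1 (hu 0 (by simpa using hc 0))
    have hf := h.factorZ (factorZ_window u j 1)
    simp only [window_succ, window_zero, hj, List.flatMap_cons, List.flatMap_nil,
      List.append_nil] at hf
    exact hf.of_infix hn

/-! ### Reduction to words without `11` -/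

/-- Boolean test for `x` being an infix of a word. -/
def occurs (x : List Bool) : List Bool → Bool
  | [] => x.isPrefixOf []
  | a :: l => x.isPrefixOf (a :: l) || occurs x l

lemma occurs_iff (x l : List Bool) : occurs x l = true ↔ x <:+: l := by
  induction l with
  | nil => simp [occurs]
  | cons a l ih => rw [occurs, Bool.or_eq_true, ih, List.infix_cons_iff, List.isPrefixOf_iff_prefix]

/-- Boolean test that no prefix of `l` with period `1`, `3`, `4` or `7` has exponent at least
`11 / 3`, and that the complement of the prefix of length `4` does not occur in `l`. -/
def admissibleHead (l : List Bool) : Bool :=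
  ([(1, 4), (3, 11), (4, 15), (7, 26)].all fun q : ℕ × ℕ =>
    !(Nat.ble q.2 l.length && ((l.take q.2).drop q.1).isPrefixOf l)) &&
  !(Nat.ble 4 l.length && occurs (comp (l.take 4)) l)

/-- The words of length `n` all of whose suffixes pass the test `admissibleHead`. -/
def admissibleWords : ℕ → List (List Bool)
  | 0 => [[]]
  | n + 1 => (admissibleWords n).flatMap fun l =>
      [false :: l, true :: l].filter admissibleHead

lemma admissibleHead_of_factorZ {w : ℤ → Bool} (hw : PowerFree w)
    (hcomp : ∀ x : List Bool, x.length = 4 → ¬(FactorZ w x ∧ FactorZ w (comp x)))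
    {l : List Bool} (hl : FactorZ w l) : admissibleHead l = true := by
  have hpow : ∀ p L : ℕ, 0 < p → p ≤ L → 11 * p ≤ 3 * L →
      (!(Nat.ble L l.length && ((l.take L).drop p).isPrefixOf l)) = true := by
    intro p L hp hpL hL
    by_contra hc
    simp only [Bool.not_eq_true', Bool.not_eq_false, Bool.and_eq_true, Nat.ble_eq,
      List.isPrefixOf_iff_prefix] at hc
    obtain ⟨hlen, hpre⟩ := hc
    have e := List.take_append_drop p (l.take L)
    have := hw ((l.take L).take p) ((l.take L).drop p)
      (by rw [e]; exact hl.of_infix (List.take_prefix _ _).isInfix)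
      (by rw [← List.length_pos_iff]; simp; omega)
      (by rw [e]; exact List.prefix_of_prefix_length_le hpre (List.take_prefix _ _) (by simp))
    simp only [List.length_take, List.length_drop] at this
    omega
  rw [admissibleHead, Bool.and_eq_true]
  constructor
  · simp only [List.all_cons, List.all_nil, Bool.and_true, Bool.and_eq_true]
    exact ⟨hpow 1 4 (by omega) (by omega) (by omega), hpow 3 11 (by omega) (by omega) (by omega),
      hpow 4 15 (by omega) (by omega) (by omega), hpow 7 26 (by omega) (by omega) (by omega)⟩
  · by_contra hc
    simp only [Bool.not_eq_true', Bool.not_eq_false, Bool.and_eq_true, Nat.ble_eq,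
      occurs_iff] at hc
    exact hcomp (l.take 4) (by simp; omega)
      ⟨hl.of_infix (List.take_prefix _ _).isInfix, hl.of_infix hc.2⟩

lemma window_mem_admissibleWords {w : ℤ → Bool} (hw : PowerFree w)
    (hcomp : ∀ x : List Bool, x.length = 4 → ¬(FactorZ w x ∧ FactorZ w (comp x)))
    (i : ℤ) (n : ℕ) : window w i n ∈ admissibleWords n := by
  induction n generalizing i with
  | zero => simp [admissibleWords, window_zero]
  | succ n ih =>
    have hadm := admissibleHead_of_factorZ hw hcomp (factorZ_window w i (n + 1))
    rw [window_succ] at hadm ⊢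
    refine List.mem_flatMap.2 ⟨_, ih (i + 1), List.mem_filter.2 ⟨?_, hadm⟩⟩
    cases w i <;> simp

lemma admissibleWords_not_mixed : ((admissibleWords 26).all fun l =>
    !(occurs [false, false] ((l.drop 10).take 6) && occurs [true, true] ((l.drop 10).take 6)))
      = true := by
  decide +kernel

lemma window_not_mixed {w : ℤ → Bool} (hw : PowerFree w)
    (hcomp : ∀ x : List Bool, x.length = 4 → ¬(FactorZ w x ∧ FactorZ w (comp x))) (i : ℤ) :
    ¬([false, false] <:+: window w i 6 ∧ [true, true] <:+: window w i 6) := by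
  have h := List.all_eq_true.1 admissibleWords_not_mixed _
    (window_mem_admissibleWords hw hcomp (i - 10) 26)
  have e : ((window w (i - 10) 26).drop 10).take 6 = window w i 6 := by
    rw [show 26 = 10 + (6 + 10) by rfl, window_add, window_add,
      List.drop_left' (length_window _ _ _), List.take_left' (length_window _ _ _)]
    simp
  rw [e] at h
  rintro ⟨h0, h1⟩
  rw [← occurs_iff] at h0 h1
  simp [h0, h1] at h

lemma pair_infix_window {w : ℤ → Bool} {b : Bool} {i j : ℤ} {n : ℕ} (h0 : w j = b)
    (h1 : w (j + 1) = b) (hij : i ≤ j) (hj : j + 2 ≤ i + n) : [b, b] <:+: window w i n := by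
  have := window_infix w i j 2 n hij (by exact_mod_cast hj)
  simpa [window_succ, window_zero, h0, h1] using this

lemma exists_double {w : ℤ → Bool}
    (hcomp : ∀ x : List Bool, x.length = 4 → ¬(FactorZ w x ∧ FactorZ w (comp x))) (i : ℤ) :
    ∃ j, i ≤ j ∧ j ≤ i + 3 ∧ w j = w (j + 1) := by
  by_contra! hc
  have h0 := hc i (by omega) (by omega)
  have h1 := hc (i + 1) (by omega) (by omega)
  have h2 := hc (i + 2) (by omega) (by omega)
  have h3 := hc (i + 3) (by omega) (by omega)
  refine hcomp (window w i 4) (by simp) ⟨factorZ_window _ _ _, ?_⟩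
  have e : comp (window w i 4) = window w (i + 1) 4 := by
    simp only [window_succ, window_zero, comp, add_assoc, Int.reduceAdd, List.map_cons,
      List.map_nil] at *
    revert h0 h1 h2 h3
    generalize w i = a, w (i + 1) = b, w (i + 2) = c, w (i + 3) = d, w (i + 4) = e
    decide +revert
  rw [e]
  exact factorZ_window _ _ _

/-- The word `w` cannot contain both `00` and `11`. -/
lemma noOneOne_or {w : ℤ → Bool} (hw : PowerFree w)
    (hcomp : ∀ x : List Bool, x.length = 4 → ¬(FactorZ w x ∧ FactorZ w (comp x))) :
    NoOneOne w ∨ NoOneOne fun i => !(w i) := by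
  have hpair : ∀ (b : Bool) (j k : ℤ), w j = b → w (j + 1) = b → w k = !b → w (k + 1) = !b →
      ∀ i, i ≤ j → j ≤ i + 4 → i ≤ k → k ≤ i + 4 → False := by
    intro b j k hj hj' hk hk' i h1 h2 h3 h4
    have hb := pair_infix_window (n := 6) hj hj' h1 (by push_cast; omega)
    have hb' := pair_infix_window (n := 6) hk hk' h3 (by push_cast; omega)
    refine window_not_mixed hw hcomp i ?_
    cases b
    · exact ⟨hb, hb'⟩
    · exact ⟨hb', hb⟩
  obtain ⟨j₀, -, -, hj₀⟩ := exists_double hcomp 0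
  have hall : ∀ i, ∃ j, i ≤ j ∧ j ≤ i + 3 ∧ w j = w j₀ ∧ w (j + 1) = w j₀ := by
    intro i
    induction i using Int.inductionOn' (b := j₀) with
    | zero => exact ⟨j₀, by omega, by omega, rfl, hj₀.symm⟩
    | succ i _ ih =>
      obtain ⟨j, h1, h2, h3, h4⟩ := ih
      obtain ⟨k, k1, k2, k3⟩ := exists_double hcomp (i + 1)
      refine ⟨k, k1, k2, ?_⟩
      by_contra hc
      rw [← k3, and_self] at hc
      have hk := Bool.eq_not.2 hc
      exact hpair _ j k h3 h4 hk (k3 ▸ hk) i (by omega) (by omega) (by omega) (by omega)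
    | pred i _ ih =>
      obtain ⟨j, h1, h2, h3, h4⟩ := ih
      obtain ⟨k, k1, k2, k3⟩ := exists_double hcomp (i - 1)
      refine ⟨k, k1, k2, ?_⟩
      by_contra hc
      rw [← k3, and_self] at hc
      have hk := Bool.eq_not.2 hc
      exact hpair _ j k h3 h4 hk (k3 ▸ hk) (i - 1) (by omega) (by omega) (by omega)
        (by omega)
  have hno : ∀ k, ¬(w k = (!(w j₀)) ∧ w (k + 1) = !(w j₀)) := by
    rintro k ⟨hk, hk'⟩
    obtain ⟨j, h1, h2, h3, h4⟩ := hall k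
    exact hpair _ j k h3 h4 hk hk' k (by omega) (by omega) (by omega) (by omega)
  cases hb : w j₀
  · left
    intro k hk
    have := hno k
    simp_all
  · right
    intro k hk
    have := hno k
    simp_all

lemma no_one_zero_one {w : ℤ → Bool} (h11 : NoOneOne w)
    (hcomp : ∀ x : List Bool, x.length = 4 → ¬(FactorZ w x ∧ FactorZ w (comp x))) (j : ℤ) :
    ¬(w j = true ∧ w (j + 1) = false ∧ w (j + 2) = true) := by
  rintro ⟨h0, h1, h2⟩
  have h3 : w (j + 3) = false := by simpa [add_assoc] using h11 _ h2
  have hm : w (j - 1) = false := by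
    by_contra hc
    have := h11 (j - 1) (by simpa using hc)
    simp_all
  have e : window w j 4 = comp (window w (j - 1) 4) := by
    simp [window_succ, window_zero, comp, add_assoc, h0, h1, h2, h3, hm]
  exact hcomp (window w (j - 1) 4) (by simp)
    ⟨factorZ_window _ _ _, e ▸ factorZ_window _ _ _⟩

theorem stmt16 (w : ℤ → Bool)
    (hfree : ∀ x : List Bool, FactorZ w x → x ≠ [] → expo x < 11 / 3)
    (hcomp : ∀ x : List Bool, x.length = 4 → ¬(FactorZ w x ∧ FactorZ w (comp x))) :
    (∀ x : List Bool, FactorZ w x ↔ FactorN hF x) ∨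
    (∀ x : List Bool, FactorZ w x ↔ FactorN (fun n => !(hF n)) x) := by
  have hw := powerFree_of_expo_lt hfree
  rcases noOneOne_or hw hcomp with h11 | h11
  · exact .inl fun x => factorZ_iff_factorN_hF hw h11 (no_one_zero_one h11 hcomp) x
  · right
    intro x
    have h := factorZ_iff_factorN_hF hw.not h11 (no_one_zero_one h11 fun y hy ⟨h1, h2⟩ =>
      hcomp y hy ⟨by simpa [factorZ_not_iff, comp_comp] using h2,
        by simpa [factorZ_not_iff] using h1⟩) (comp x)
    rw [factorN_not_iff, ← h, factorZ_not_iff, comp_comp]
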